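/- Every STARC metric d is complete: there exists a positive constant L such that for all reward functions R1, R2 there exist policies π1, π2 with J_{R2}(π2) ≥ J_{R2}(π1) and J_{R1}(π1) − J_{R1}(π2) ≥ L · (max_π J_{R1}(π) − min_π J_{R1}(π)) · d(R1,R2); moreover, d(R1,R2) = 0 whenever R1 and R2 induce the same ordering of policies. -/

import Mathlib

namespace RewardPaper

/-- A probability distribution on a finite type, represented as a function. -/
def IsDist {X : Type*} [Fintype X] (p : X → ℝ) : Prop :=
  (∀ x, 0 ≤ p x) ∧ (∑ x, p x) = 1

/-- Reward functions on `S × A × S`. -/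
abbrev Reward (S A : Type*) := S → A → S → ℝ

/-- A policy assigns to each state a probability distribution over actions. -/
def IsPolicy {S A : Type*} [Fintype A] (π : S → A → ℝ) : Prop := ∀ s, IsDist (π s)

/-- The type of policies. -/
abbrev Policy (S A : Type*) [Fintype A] := {π : S → A → ℝ // IsPolicy π}

/-- The distribution over states at time `t` of the Markov chain induced by
`τ`, `μ0` and the policy `π`. -/
noncomputable def stateDist {S A : Type*} [Fintype S] [Fintype A]
    (τ : S → A → S → ℝ) (μ0 : S → ℝ) (π : S → A → ℝ) : ℕ → S → ℝ
  | 0 => μ0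
  | (t + 1) => fun s' => ∑ s, ∑ a, stateDist τ μ0 π t s * π s a * τ s a s'

/-- Policy evaluation function `J_R(π)`: expected discounted return of `π` under `R`. -/
noncomputable def J {S A : Type*} [Fintype S] [Fintype A]
    (τ : S → A → S → ℝ) (μ0 : S → ℝ) (γ : ℝ) (R : Reward S A)
    (π : S → A → ℝ) : ℝ :=
  ∑' t : ℕ, γ ^ t * ∑ s, ∑ a, ∑ s', stateDist τ μ0 π t s * π s a * τ s a s' * R s a s'

/-- The value function `V^π_R(s)`: expected discounted return starting from `s`. -/
noncomputable def V {S A : Type*} [Fintype S] [Fintype A] [DecidableEq S]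
    (τ : S → A → S → ℝ) (γ : ℝ) (R : Reward S A) (π : S → A → ℝ) (s : S) : ℝ :=
  J τ (fun s0 => if s0 = s then 1 else 0) γ R π

/-- Every state is reachable with positive probability under `τ` from `μ0`. -/
def AllReachable {S A : Type*} [Fintype S] [Fintype A]
    (τ : S → A → S → ℝ) (μ0 : S → ℝ) : Prop :=
  ∀ s, ∃ (π : S → A → ℝ) (t : ℕ), IsPolicy π ∧ 0 < stateDist τ μ0 π t s

/-- `R2` is produced by potential shaping of `R1`. -/
def PotentialShaping {S A : Type*} (γ : ℝ) (R1 R2 : Reward S A) : Prop :=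
  ∃ Φ : S → ℝ, ∀ s a s', R2 s a s' = R1 s a s' + γ * Φ s' - Φ s

/-- `R1` and `R2` differ by S'-redistribution with respect to `τ`. -/
def SRedist {S A : Type*} [Fintype S] (τ : S → A → S → ℝ) (R1 R2 : Reward S A) : Prop :=
  ∀ s a, (∑ s', τ s a s' * R1 s a s') = (∑ s', τ s a s' * R2 s a s')

/-- `R1` and `R2` differ by (a composition of) potential shaping and S'-redistribution. -/
def DifferBy {S A : Type*} [Fintype S] (γ : ℝ) (τ : S → A → S → ℝ)
    (R1 R2 : Reward S A) : Prop :=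
  ∃ R' : Reward S A, PotentialShaping γ R1 R' ∧ SRedist τ R' R2

/-- A canonicalisation function. -/
def IsCanon {S A : Type*} [Fintype S] (γ : ℝ) (τ : S → A → S → ℝ)
    (c : Reward S A → Reward S A) : Prop :=
  IsLinearMap ℝ c ∧ (∀ R, DifferBy γ τ R (c R)) ∧
    ∀ R1 R2, c R1 = c R2 ↔ DifferBy γ τ R1 R2

/-- `n` is a norm on the subset `X` of reward space. -/
def IsNormOn {S A : Type*} (X : Set (Reward S A)) (n : Reward S A → ℝ) : Prop :=
  (∀ x ∈ X, 0 ≤ n x) ∧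
  (∀ x ∈ X, (n x = 0 ↔ x = 0)) ∧
  (∀ x ∈ X, ∀ r : ℝ, n (r • x) = |r| * n x) ∧
  (∀ x ∈ X, ∀ y ∈ X, n (x + y) ≤ n x + n y)

/-- `p` is a norm on all of reward space. -/
def IsNorm {S A : Type*} (p : Reward S A → ℝ) : Prop := IsNormOn Set.univ p

/-- `m` is a metric on the subset `X` of reward space. -/
def IsMetricOn {S A : Type*} (X : Set (Reward S A)) (m : Reward S A → Reward S A → ℝ) : Prop :=
  (∀ x ∈ X, m x x = 0) ∧ (∀ x ∈ X, ∀ y ∈ X, 0 ≤ m x y) ∧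
  (∀ x ∈ X, ∀ y ∈ X, m x y = m y x) ∧
  (∀ x ∈ X, ∀ y ∈ X, ∀ z ∈ X, m x z ≤ m x y + m y z)

/-- `m` is an admissible metric on `X`: a metric bilipschitz equivalent to some norm. -/
def IsAdmissibleOn {S A : Type*} (X : Set (Reward S A))
    (m : Reward S A → Reward S A → ℝ) : Prop :=
  IsMetricOn X m ∧
  ∃ (p : Reward S A → ℝ) (l u : ℝ), IsNorm p ∧ 0 < l ∧ 0 < u ∧
    ∀ x ∈ X, ∀ y ∈ X, l * p (x - y) ≤ m x y ∧ m x y ≤ u * p (x - y)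

/-- `d` is a STARC metric. -/
def IsSTARC {S A : Type*} [Fintype S] (γ : ℝ) (τ : S → A → S → ℝ)
    (d : Reward S A → Reward S A → ℝ) : Prop :=
  ∃ (c : Reward S A → Reward S A) (n : Reward S A → ℝ)
    (m : Reward S A → Reward S A → ℝ) (s : Reward S A → Reward S A),
    IsCanon γ τ c ∧ IsNormOn (Set.range c) n ∧
    (∀ R, (n (c R) = 0 → s R = c R) ∧ (n (c R) ≠ 0 → s R = (n (c R))⁻¹ • c R)) ∧
    IsAdmissibleOn (Set.range s) m ∧
    ∀ R1 R2, d R1 R2 = m (s R1) (s R2)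

/-- An EPIC-like canonicalisation function: standardises potential shaping only. -/
def IsEpicLikeCanon {S A : Type*} (γ : ℝ) (c : Reward S A → Reward S A) : Prop :=
  IsLinearMap ℝ c ∧ (∀ R, PotentialShaping γ R (c R)) ∧
    ∀ R1 R2, c R1 = c R2 ↔ PotentialShaping γ R1 R2

/-- `d` is an EPIC-like metric. -/
def IsEpicLike {S A : Type*} (γ : ℝ) (d : Reward S A → Reward S A → ℝ) : Prop :=
  ∃ (c : Reward S A → Reward S A) (n : Reward S A → ℝ)
    (m : Reward S A → Reward S A → ℝ) (s : Reward S A → Reward S A),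
    IsEpicLikeCanon γ c ∧ IsNormOn (Set.range c) n ∧
    (∀ R, (n (c R) = 0 → s R = c R) ∧ (n (c R) ≠ 0 → s R = (n (c R))⁻¹ • c R)) ∧
    IsAdmissibleOn (Set.range c) m ∧
    ∀ R1 R2, d R1 R2 = m (s R1) (s R2)

/-- The maximal value of `J_R` over all policies. -/
noncomputable def maxJ {S A : Type*} [Fintype S] [Fintype A]
    (τ : S → A → S → ℝ) (μ0 : S → ℝ) (γ : ℝ) (R : Reward S A) : ℝ :=
  ⨆ π : Policy S A, J τ μ0 γ R π.1

/-- The minimal value of `J_R` over all policies. -/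
noncomputable def minJ {S A : Type*} [Fintype S] [Fintype A]
    (τ : S → A → S → ℝ) (μ0 : S → ℝ) (γ : ℝ) (R : Reward S A) : ℝ :=
  ⨅ π : Policy S A, J τ μ0 γ R π.1

/-- `R1` and `R2` induce the same ordering of policies. -/
def SameOrder {S A : Type*} [Fintype S] [Fintype A]
    (τ : S → A → S → ℝ) (μ0 : S → ℝ) (γ : ℝ) (R1 R2 : Reward S A) : Prop :=
  ∀ π π' : Policy S A,
    (J τ μ0 γ R1 π.1 ≤ J τ μ0 γ R1 π'.1 ↔ J τ μ0 γ R2 π.1 ≤ J τ μ0 γ R2 π'.1)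

/-- Soundness of a pseudometric on reward space. -/
def Sound {S A : Type*} [Fintype S] [Fintype A]
    (τ : S → A → S → ℝ) (μ0 : S → ℝ) (γ : ℝ)
    (d : Reward S A → Reward S A → ℝ) : Prop :=
  ∃ U : ℝ, 0 < U ∧ ∀ (R1 R2 : Reward S A) (π1 π2 : Policy S A),
    J τ μ0 γ R2 π1.1 ≤ J τ μ0 γ R2 π2.1 →
    J τ μ0 γ R1 π1.1 - J τ μ0 γ R1 π2.1 ≤
      U * (maxJ τ μ0 γ R1 - minJ τ μ0 γ R1) * d R1 R2

/-- Completeness of a pseudometric on reward space. -/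
def Complete {S A : Type*} [Fintype S] [Fintype A]
    (τ : S → A → S → ℝ) (μ0 : S → ℝ) (γ : ℝ)
    (d : Reward S A → Reward S A → ℝ) : Prop :=
  (∃ L : ℝ, 0 < L ∧ ∀ R1 R2 : Reward S A, ∃ π1 π2 : Policy S A,
    J τ μ0 γ R2 π1.1 ≤ J τ μ0 γ R2 π2.1 ∧
    L * (maxJ τ μ0 γ R1 - minJ τ μ0 γ R1) * d R1 R2 ≤
      J τ μ0 γ R1 π1.1 - J τ μ0 γ R1 π2.1) ∧
  ∀ R1 R2 : Reward S A, SameOrder τ μ0 γ R1 R2 → d R1 R2 = 0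

/-- `d` is a pseudometric on reward space. -/
def IsPseudometric {S A : Type*} (d : Reward S A → Reward S A → ℝ) : Prop :=
  (∀ x, d x x = 0) ∧ (∀ x y, 0 ≤ d x y) ∧ (∀ x y, d x y = d y x) ∧
    ∀ x y z, d x z ≤ d x y + d y z

/-- The EPIC canonicalisation. -/
noncomputable def CEpic {S A : Type*} [Fintype S] [Fintype A]
    (DS : S → ℝ) (DA : A → ℝ) (γ : ℝ) (R : Reward S A) : Reward S A :=
  fun s a s' =>
    R s a s'
      + γ * (∑ a', ∑ σ', DA a' * DS σ' * R s' a' σ')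
      - (∑ a', ∑ σ', DA a' * DS σ' * R s a' σ')
      - γ * (∑ σ, ∑ a', ∑ σ', DS σ * DA a' * DS σ' * R σ a' σ')

/-- Mean of `f(S,A,S')` with `S,S' ~ DS` and `A ~ DA` independent. -/
noncomputable def meanD {S A : Type*} [Fintype S] [Fintype A]
    (DS : S → ℝ) (DA : A → ℝ) (f : Reward S A) : ℝ :=
  ∑ s, ∑ a, ∑ s', DS s * DA a * DS s' * f s a s'

/-- Covariance of `f(S,A,S')` and `g(S,A,S')`. -/
noncomputable def covD {S A : Type*} [Fintype S] [Fintype A]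
    (DS : S → ℝ) (DA : A → ℝ) (f g : Reward S A) : ℝ :=
  ∑ s, ∑ a, ∑ s', DS s * DA a * DS s' *
    (f s a s' - meanD DS DA f) * (g s a s' - meanD DS DA g)

/-- Variance of `f(S,A,S')`. -/
noncomputable def varD {S A : Type*} [Fintype S] [Fintype A]
    (DS : S → ℝ) (DA : A → ℝ) (f : Reward S A) : ℝ :=
  covD DS DA f f

/-- Pearson correlation of `f(S,A,S')` and `g(S,A,S')`. -/
noncomputable def pearsonD {S A : Type*} [Fintype S] [Fintype A]
    (DS : S → ℝ) (DA : A → ℝ) (f g : Reward S A) : ℝ :=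
  covD DS DA f g / (Real.sqrt (varD DS DA f) * Real.sqrt (varD DS DA g))

/-- The EPIC distance. -/
noncomputable def DEpic {S A : Type*} [Fintype S] [Fintype A]
    (DS : S → ℝ) (DA : A → ℝ) (γ : ℝ) (R1 R2 : Reward S A) : ℝ :=
  Real.sqrt ((1 - pearsonD DS DA (CEpic DS DA γ R1) (CEpic DS DA γ R2)) / 2)

/-- The DARD canonicalisation. -/
noncomputable def CDard {S A : Type*} [Fintype S] [Fintype A]
    (τ : S → A → S → ℝ) (DA : A → ℝ) (γ : ℝ) (R : Reward S A) : Reward S A :=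
  fun s a s' =>
    R s a s' + ∑ a', DA a' *
      (γ * (∑ σ'', τ s' a' σ'' * R s' a' σ'')
        - (∑ σ', τ s a' σ' * R s a' σ')
        - γ * (∑ σ', ∑ σ'', τ s a' σ' * τ s' a' σ'' * R σ' a' σ''))

/-- The DARD distance. -/
noncomputable def DDard {S A : Type*} [Fintype S] [Fintype A]
    (τ : S → A → S → ℝ) (DS : S → ℝ) (DA : A → ℝ) (γ : ℝ) (R1 R2 : Reward S A) : ℝ :=
  Real.sqrt ((1 - pearsonD DS DA (CDard τ DA γ R1) (CDard τ DA γ R2)) / 2)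

/-- The (unweighted) L2 norm on reward space. -/
noncomputable def l2Norm {S A : Type*} [Fintype S] [Fintype A] (R : Reward S A) : ℝ :=
  Real.sqrt (∑ s, ∑ a, ∑ s', (R s a s') ^ 2)

/-- A weighted L2 norm on reward space. -/
noncomputable def weightedL2 {S A : Type*} [Fintype S] [Fintype A]
    (w : S → A → S → ℝ) (R : Reward S A) : ℝ :=
  Real.sqrt (∑ s, ∑ a, ∑ s', w s a s' * (R s a s') ^ 2)

/-- The L2 norm weighted by the product distribution `DS ⊗ DA ⊗ DS`. -/
noncomputable def l2NormD {S A : Type*} [Fintype S] [Fintype A]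
    (DS : S → ℝ) (DA : A → ℝ) (R : Reward S A) : ℝ :=
  Real.sqrt (∑ s, ∑ a, ∑ s', DS s * DA a * DS s' * (R s a s') ^ 2)

/-- Expected discounted return of a reward function along a sequence of per-timestep
transition distributions. -/
noncomputable def Eret {S A : Type*} [Fintype S] [Fintype A]
    (γ : ℝ) (R : Reward S A) (p : ℕ → (S × A × S) → ℝ) : ℝ :=
  ∑' t : ℕ, γ ^ t * ∑ x : S × A × S, p t x * R x.1 x.2.1 x.2.2


theorem seminorm_bound {E : Type*} [AddCommGroup E] [Module ℝ E] [FiniteDimensional ℝ E]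
    (n p : E → ℝ) (hn0 : ∀ x, 0 ≤ n x) (hnz : ∀ x, n x = 0 → x = 0)
    (hns : ∀ (r : ℝ) x, n (r • x) = |r| * n x) (hna : ∀ x y, n (x + y) ≤ n x + n y)
    (hp0 : ∀ x, 0 ≤ p x)
    (hps : ∀ (r : ℝ) x, p (r • x) = |r| * p x) (hpa : ∀ x y, p (x + y) ≤ p x + p y) :
    ∃ C : ℝ, 0 < C ∧ ∀ x, p x ≤ C * n x := by
  have hz : ∀ q : E → ℝ, (∀ (r : ℝ) x, q (r • x) = |r| * q x) → q 0 = 0 := by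
    intro q hq
    have := hq 0 0
    simpa using this
  let _inst : Norm E := ⟨n⟩
  have core : NormedSpace.Core ℝ E :=
    { norm_nonneg := hn0
      norm_smul := fun r x => hns r x
      norm_triangle := hna
      norm_eq_zero_iff := fun x => ⟨hnz x, fun h => h ▸ hz n hns⟩ }
  let _inst2 : NormedAddCommGroup E := NormedAddCommGroup.ofCore core
  let _inst3 : NormedSpace ℝ E := NormedSpace.ofCore core
  let b := Module.finBasis ℝ E
  have hb : ∀ i, ∃ K : ℝ, 0 < K ∧ ∀ x, |b.coord i x| ≤ K * n x := by
    intro i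
    obtain ⟨K, hK, h⟩ := (LinearMap.toContinuousLinearMap (b.coord i)).bound
    exact ⟨K, hK, h⟩
  choose K hK hKb using hb
  refine ⟨1 + ∑ i, K i * p (b i), ?_, ?_⟩
  · have : 0 ≤ ∑ i, K i * p (b i) :=
      Finset.sum_nonneg fun i _ => mul_nonneg (hK i).le (hp0 _)
    linarith
  · intro x
    have h1 : p x ≤ ∑ i, |b.coord i x| * p (b i) := by
      conv_lhs => rw [← b.sum_repr x]
      refine (Finset.le_sum_of_subadditive p (hz p hps).le hpa _ _).trans ?_
      refine Finset.sum_le_sum fun i _ => ?_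
      rw [hps]; rfl
    have h2 : ∑ i, |b.coord i x| * p (b i) ≤ ∑ i, (K i * p (b i)) * n x := by
      refine Finset.sum_le_sum fun i _ => ?_
      nlinarith [hKb i x, hp0 (b i)]
    rw [← Finset.sum_mul] at h2
    have := hn0 x
    linarith

section
variable {S A : Type*} [Fintype S] [Fintype A]


/-- Expected one-step reward, as a linear map. -/
noncomputable def rho (τ : S → A → S → ℝ) : Reward S A →ₗ[ℝ] EuclideanSpace ℝ (S × A) where
  toFun R := WithLp.toLp 2 (fun q => ∑ s', τ q.1 q.2 s' * R q.1 q.2 s')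
  map_add' x y := by
    ext q
    simp [mul_add, Finset.sum_add_distrib]
  map_smul' r x := by
    ext q
    simp only [Pi.smul_apply, smul_eq_mul, RingHom.id_apply, PiLp.smul_apply, Finset.mul_sum]
    exact Finset.sum_congr rfl fun _ _ => by ring

/-- Expected potential shaping, as a linear map. -/
noncomputable def shp (γ : ℝ) (τ : S → A → S → ℝ) :
    (S → ℝ) →ₗ[ℝ] EuclideanSpace ℝ (S × A) where
  toFun Φ := WithLp.toLp 2 (fun q => γ * (∑ s', τ q.1 q.2 s' * Φ s') - Φ q.1)
  map_add' x y := by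
    ext q
    simp [mul_add, Finset.sum_add_distrib]
    ring
  map_smul' r x := by
    ext q
    have : ∑ s', τ q.1 q.2 s' * (r * x s') = r * ∑ s', τ q.1 q.2 s' * x s' := by
      rw [Finset.mul_sum]
      exact Finset.sum_congr rfl fun _ _ => by ring
    simp only [Pi.smul_apply, smul_eq_mul, RingHom.id_apply, PiLp.smul_apply, this]
    ring

theorem rho_apply (τ : S → A → S → ℝ) (R : Reward S A) (s : S) (a : A) :
    rho τ R (s, a) = ∑ s', τ s a s' * R s a s' := rfl

theorem shp_apply (γ : ℝ) (τ : S → A → S → ℝ) (Φ : S → ℝ) (s : S) (a : A) :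
    shp γ τ Φ (s, a) = γ * (∑ s', τ s a s' * Φ s') - Φ s := rfl

theorem inner_eq (x y : EuclideanSpace ℝ (S × A)) :
    inner ℝ (x) (y) = ∑ s, ∑ a, x (s, a) * y (s, a) := by
  rw [PiLp.inner_apply, Fintype.sum_prod_type]
  refine Finset.sum_congr rfl fun _ _ => Finset.sum_congr rfl fun _ _ => ?_
  simp [mul_comm]

theorem differBy_iff (γ : ℝ) (τ : S → A → S → ℝ) (hτ : ∀ s a, IsDist (τ s a))
    (R1 R2 : Reward S A) :
    DifferBy γ τ R1 R2 ↔ ∃ Φ, rho τ R2 = rho τ R1 + shp γ τ Φ := by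
  have key : ∀ (Φ : S → ℝ) s a, ∑ s', τ s a s' * (R1 s a s' + γ * Φ s' - Φ s) =
      rho τ R1 (s, a) + shp γ τ Φ (s, a) := by
    intro Φ s a
    rw [rho_apply, shp_apply]
    have h1 := (hτ s a).2
    calc _ = ∑ s', (τ s a s' * R1 s a s' + γ * (τ s a s' * Φ s') - τ s a s' * Φ s) :=
          Finset.sum_congr rfl fun _ _ => by ring
      _ = _ := by
        rw [Finset.sum_sub_distrib, Finset.sum_add_distrib, ← Finset.mul_sum, ← Finset.sum_mul, h1]
        ring
  constructor
  · rintro ⟨R', ⟨Φ, hΦ⟩, h⟩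
    refine ⟨Φ, ?_⟩
    ext ⟨s, a⟩
    rw [PiLp.add_apply, ← key, rho_apply, ← h s a]
    simp only [hΦ]
  · rintro ⟨Φ, h⟩
    refine ⟨fun s a s' => R1 s a s' + γ * Φ s' - Φ s, ⟨Φ, fun _ _ _ => rfl⟩, fun s a => ?_⟩
    rw [key, ← rho_apply, h]
    rfl

/-- State occupancy. -/
noncomputable def socc (τ : S → A → S → ℝ) (μ0 : S → ℝ) (γ : ℝ) (π : S → A → ℝ) (s : S) : ℝ :=
  ∑' t : ℕ, γ ^ t * stateDist τ μ0 π t s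

/-- State-action occupancy. -/
noncomputable def occ (τ : S → A → S → ℝ) (μ0 : S → ℝ) (γ : ℝ) (π : S → A → ℝ) :
    EuclideanSpace ℝ (S × A) :=
  WithLp.toLp 2 (fun q => socc τ μ0 γ π q.1 * π q.1 q.2)

theorem occ_apply (τ : S → A → S → ℝ) (μ0 : S → ℝ) (γ : ℝ) (π : S → A → ℝ) (s : S) (a : A) :
    occ τ μ0 γ π (s, a) = socc τ μ0 γ π s * π s a := rfl

theorem stateDist_dist (τ : S → A → S → ℝ) (hτ : ∀ s a, IsDist (τ s a))
    (μ0 : S → ℝ) (hμ0 : IsDist μ0) (π : S → A → ℝ) (hπ : IsPolicy π) (t : ℕ) :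
    IsDist (stateDist τ μ0 π t) := by
  induction t with
  | zero => exact hμ0
  | succ t ih =>
    refine ⟨fun s' => ?_, ?_⟩
    · exact Finset.sum_nonneg fun s _ => Finset.sum_nonneg fun a _ =>
        mul_nonneg (mul_nonneg (ih.1 s) ((hπ s).1 a)) ((hτ s a).1 s')
    · change ∑ s', ∑ s, ∑ a, stateDist τ μ0 π t s * π s a * τ s a s' = 1
      rw [Finset.sum_comm]
      have : ∀ s, ∑ s', ∑ a, stateDist τ μ0 π t s * π s a * τ s a s' = stateDist τ μ0 π t s := by
        intro s
        rw [Finset.sum_comm]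
        simp_rw [← Finset.mul_sum, (hτ s _).2, mul_one, ← Finset.mul_sum, (hπ s).2, mul_one]
      simp_rw [this]
      exact ih.2

theorem isDist_le_one {X : Type*} [Fintype X] {p : X → ℝ} (hp : IsDist p) (x : X) : p x ≤ 1 := by
  rw [← hp.2]
  exact Finset.single_le_sum (fun i _ => hp.1 i) (Finset.mem_univ x)

theorem summable_sd (τ : S → A → S → ℝ) (hτ : ∀ s a, IsDist (τ s a))
    (μ0 : S → ℝ) (hμ0 : IsDist μ0) (γ : ℝ) (hγ : γ ∈ Set.Ioo (0 : ℝ) 1)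
    (π : S → A → ℝ) (hπ : IsPolicy π) (s : S) :
    Summable fun t : ℕ => γ ^ t * stateDist τ μ0 π t s := by
  refine Summable.of_nonneg_of_le (fun t => ?_) (fun t => ?_)
    (summable_geometric_of_lt_one hγ.1.le hγ.2)
  · exact mul_nonneg (pow_nonneg hγ.1.le t) ((stateDist_dist τ hτ μ0 hμ0 π hπ t).1 s)
  · exact mul_le_of_le_one_right (pow_nonneg hγ.1.le t)
      (isDist_le_one (stateDist_dist τ hτ μ0 hμ0 π hπ t) s)

theorem J_eq (τ : S → A → S → ℝ) (hτ : ∀ s a, IsDist (τ s a))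
    (μ0 : S → ℝ) (hμ0 : IsDist μ0) (γ : ℝ) (hγ : γ ∈ Set.Ioo (0 : ℝ) 1)
    (π : S → A → ℝ) (hπ : IsPolicy π) (R : Reward S A) :
    J τ μ0 γ R π = inner ℝ (occ τ μ0 γ π) (rho τ R) := by
  have hs := summable_sd τ hτ μ0 hμ0 γ hγ π hπ
  rw [inner_eq]
  unfold J
  have h1 : ∀ t : ℕ, γ ^ t * ∑ s, ∑ a, ∑ s', stateDist τ μ0 π t s * π s a * τ s a s' * R s a s' =
      ∑ s, (γ ^ t * stateDist τ μ0 π t s) * ∑ a, π s a * rho τ R (s, a) := by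
    intro t
    simp only [rho_apply, Finset.mul_sum]
    refine Finset.sum_congr rfl fun _ _ => Finset.sum_congr rfl fun _ _ =>
      Finset.sum_congr rfl fun _ _ => by ring
  simp_rw [h1]
  rw [Summable.tsum_finsetSum (fun s _ => (hs s).mul_right _)]
  refine Finset.sum_congr rfl fun s _ => ?_
  rw [tsum_mul_right, Finset.mul_sum]
  refine Finset.sum_congr rfl fun a _ => ?_
  rw [occ_apply, socc]
  ring

theorem socc_flow (τ : S → A → S → ℝ) (hτ : ∀ s a, IsDist (τ s a))
    (μ0 : S → ℝ) (hμ0 : IsDist μ0) (γ : ℝ) (hγ : γ ∈ Set.Ioo (0 : ℝ) 1)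
    (π : S → A → ℝ) (hπ : IsPolicy π) (s' : S) :
    socc τ μ0 γ π s' = μ0 s' + γ * ∑ s, ∑ a, socc τ μ0 γ π s * π s a * τ s a s' := by
  have hs := summable_sd τ hτ μ0 hμ0 γ hγ π hπ
  conv_lhs => rw [socc, (hs s').tsum_eq_zero_add]
  have h1 : ∀ t : ℕ, γ ^ (t + 1) * stateDist τ μ0 π (t + 1) s' =
      ∑ s, (γ ^ t * stateDist τ μ0 π t s) * (γ * ∑ a, π s a * τ s a s') := by
    intro t
    simp only [stateDist, Finset.mul_sum]
    refine Finset.sum_congr rfl fun _ _ => Finset.sum_congr rfl fun _ _ => by ring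
  simp_rw [h1]
  rw [Summable.tsum_finsetSum (fun s _ => (hs s).mul_right _)]
  simp only [pow_zero, one_mul, stateDist]
  congr 1
  rw [Finset.mul_sum]
  refine Finset.sum_congr rfl fun s _ => ?_
  rw [tsum_mul_right, ← socc]
  simp only [Finset.mul_sum]
  refine Finset.sum_congr rfl fun a _ => by ring

theorem inner_shp (γ : ℝ) (τ : S → A → S → ℝ) (Φ : S → ℝ) (x : EuclideanSpace ℝ (S × A)) :
    inner ℝ (shp γ τ Φ) (x) =
      ∑ s', Φ s' * (γ * (∑ s, ∑ a, x (s, a) * τ s a s') - ∑ a, x (s', a)) := by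
  rw [inner_eq]
  simp only [shp_apply, mul_sub, sub_mul, Finset.sum_sub_distrib, Finset.mul_sum, Finset.sum_mul]
  congr 1
  have : ∀ s' , ∑ s, ∑ a, Φ s' * (γ * (x (s, a) * τ s a s')) =
      ∑ s, ∑ a, γ * (τ s a s' * Φ s') * x (s, a) := by
    intro s'
    refine Finset.sum_congr rfl fun _ _ => Finset.sum_congr rfl fun _ _ => by ring
  simp_rw [this]
  symm
  rw [Finset.sum_comm]
  exact Finset.sum_congr rfl fun _ _ => Finset.sum_comm

theorem inner_shp_occ (τ : S → A → S → ℝ) (hτ : ∀ s a, IsDist (τ s a))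
    (μ0 : S → ℝ) (hμ0 : IsDist μ0) (γ : ℝ) (hγ : γ ∈ Set.Ioo (0 : ℝ) 1)
    (π : S → A → ℝ) (hπ : IsPolicy π) (Φ : S → ℝ) :
    inner ℝ (shp γ τ Φ) (occ τ μ0 γ π) = ∑ s, Φ s * (- μ0 s) := by
  rw [inner_shp]
  refine Finset.sum_congr rfl fun s' _ => ?_
  congr 1
  simp only [occ_apply]
  rw [← Finset.mul_sum, (hπ s').2, mul_one]
  have := socc_flow τ hτ μ0 hμ0 γ hγ π hπ s'
  linarith

theorem realize (τ : S → A → S → ℝ) (hτ : ∀ s a, IsDist (τ s a)) [Nonempty A]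
    (μ0 : S → ℝ) (hμ0 : IsDist μ0) (γ : ℝ) (hγ : γ ∈ Set.Ioo (0 : ℝ) 1)
    (x : EuclideanSpace ℝ (S × A)) (hx : ∀ q, 0 < x q)
    (hfl : ∀ Φ, inner ℝ (shp γ τ Φ) (x) = ∑ s, Φ s * (- μ0 s)) :
    ∃ π : Policy S A, occ τ μ0 γ π.1 = x := by
  classical
  have hY : ∀ s, 0 < ∑ a, x (s, a) := fun s => Finset.sum_pos (fun a _ => hx _) Finset.univ_nonempty
  let π : S → A → ℝ := fun s a => x (s, a) / ∑ a, x (s, a)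
  have hπ : IsPolicy π := by
    refine fun s => ⟨fun a => (div_pos (hx _) (hY s)).le, ?_⟩
    change ∑ a, x (s, a) / ∑ a, x (s, a) = 1
    rw [← Finset.sum_div, div_self (hY s).ne']
  have hxπ : ∀ s a, x (s, a) = (∑ a, x (s, a)) * π s a := fun s a => by
    simp only [π]
    rw [mul_div_cancel₀ _ (hY s).ne']
  have hYf : ∀ s', ∑ a, x (s', a) = μ0 s' + γ * ∑ s, ∑ a, x (s, a) * τ s a s' := by
    intro s'
    have h := hfl (Pi.single s' 1)
    rw [inner_shp] at h
    simp [Pi.single_apply] at h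
    linarith
  let D : S → ℝ := fun s => (∑ a, x (s, a)) - socc τ μ0 γ π s
  have hD : ∀ s', D s' = γ * ∑ s, ∑ a, D s * π s a * τ s a s' := by
    intro s'
    simp only [D]
    rw [hYf s', socc_flow τ hτ μ0 hμ0 γ hγ π hπ s', add_sub_add_left_eq_sub, ← mul_sub,
      ← Finset.sum_sub_distrib]
    congr 1
    refine Finset.sum_congr rfl fun s _ => ?_
    rw [← Finset.sum_sub_distrib]
    refine Finset.sum_congr rfl fun a _ => ?_
    rw [hxπ s a]
    ring
  have hle : ∑ s', |D s'| ≤ γ * ∑ s, |D s| := by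
    calc ∑ s', |D s'| ≤ ∑ s', γ * ∑ s, ∑ a, |D s| * π s a * τ s a s' := by
          refine Finset.sum_le_sum fun s' _ => ?_
          conv_lhs => rw [hD s']
          rw [abs_mul, abs_of_pos hγ.1]
          refine mul_le_mul_of_nonneg_left ?_ hγ.1.le
          refine (Finset.abs_sum_le_sum_abs _ _).trans (Finset.sum_le_sum fun s _ => ?_)
          refine (Finset.abs_sum_le_sum_abs _ _).trans (Finset.sum_le_sum fun a _ => ?_)
          rw [abs_mul, abs_mul, abs_of_nonneg ((hπ s).1 a), abs_of_nonneg ((hτ s a).1 s')]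
      _ = γ * ∑ s, |D s| := by
          rw [← Finset.mul_sum]
          congr 1
          rw [Finset.sum_comm]
          refine Finset.sum_congr rfl fun s _ => ?_
          rw [Finset.sum_comm]
          simp_rw [← Finset.mul_sum, (hτ s _).2, mul_one, ← Finset.mul_sum, (hπ s).2, mul_one]
  have h0 : ∑ s, |D s| = 0 := by
    have : 0 ≤ ∑ s, |D s| := Finset.sum_nonneg fun s _ => abs_nonneg _
    nlinarith [hγ.2]
  have hD0 : ∀ s, D s = 0 := by
    intro s
    have := (Finset.sum_eq_zero_iff_of_nonneg (fun s _ => abs_nonneg (D s))).1 h0 s (Finset.mem_univ s)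
    exact abs_eq_zero.1 this
  refine ⟨⟨π, hπ⟩, ?_⟩
  ext ⟨s, a⟩
  rw [occ_apply, hxπ s a]
  have := hD0 s
  simp only [D] at this
  rw [sub_eq_zero.1 this]

theorem exists_interior [Nonempty A] [Nonempty S] (τ : S → A → S → ℝ) (hτ : ∀ s a, IsDist (τ s a))
    (μ0 : S → ℝ) (hμ0 : IsDist μ0) (γ : ℝ) (hγ : γ ∈ Set.Ioo (0 : ℝ) 1)
    (hreach : AllReachable τ μ0) :
    ∃ (π : Policy S A) (ε : ℝ), 0 < ε ∧ ∀ q, ε < occ τ μ0 γ π.1 q := by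
  let k : ℝ := (Fintype.card A : ℝ)⁻¹
  have hk : 0 < k := inv_pos.2 (by exact_mod_cast Fintype.card_pos)
  let π : S → A → ℝ := fun _ _ => k
  have hπ : IsPolicy π := by
    refine fun s => ⟨fun a => hk.le, ?_⟩
    simp [π, k]
  have hge : ∀ (π' : S → A → ℝ), IsPolicy π' → ∀ t s,
      k ^ t * stateDist τ μ0 π' t s ≤ stateDist τ μ0 π t s := by
    intro π' hπ' t
    induction t with
    | zero => intro s; simp [stateDist]
    | succ t ih =>
      intro s'
      simp only [stateDist, Finset.mul_sum]
      refine Finset.sum_le_sum fun s _ => Finset.sum_le_sum fun a _ => ?_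
      have h1 : k ^ (t + 1) * (stateDist τ μ0 π' t s * π' s a * τ s a s') =
        (k ^ t * stateDist τ μ0 π' t s) * (π' s a * k) * τ s a s' := by ring
      rw [h1]
      refine mul_le_mul_of_nonneg_right ?_ ((hτ s a).1 s')
      refine mul_le_mul (ih s) ?_ (mul_nonneg ((hπ' s).1 a) hk.le)
        ((stateDist_dist τ hτ μ0 hμ0 π hπ t).1 s)
      exact mul_le_of_le_one_left hk.le (isDist_le_one (hπ' s) a)
  have hpos : ∀ q, 0 < occ τ μ0 γ π q := by
    rintro ⟨s, a⟩
    rw [occ_apply]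
    refine mul_pos ?_ hk
    obtain ⟨π', t, hπ', ht⟩ := hreach s
    refine (summable_sd τ hτ μ0 hμ0 γ hγ π hπ s).tsum_pos (fun t => ?_) t ?_
    · exact mul_nonneg (pow_nonneg hγ.1.le t) ((stateDist_dist τ hτ μ0 hμ0 π hπ t).1 s)
    · exact mul_pos (pow_pos hγ.1 t) ((mul_pos (pow_pos hk t) ht).trans_le (hge π' hπ' t s))
  obtain ⟨q0, hq0⟩ := Finite.exists_min (fun q => occ τ μ0 γ π q)
  refine ⟨⟨π, hπ⟩, occ τ μ0 γ π q0 / 2, half_pos (hpos q0), fun q => ?_⟩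
  have := hq0 q
  have := hpos q0
  change _ < occ τ μ0 γ π q
  linarith

theorem J_diff_le (τ : S → A → S → ℝ) (hτ : ∀ s a, IsDist (τ s a))
    (μ0 : S → ℝ) (hμ0 : IsDist μ0) (γ : ℝ) (hγ : γ ∈ Set.Ioo (0 : ℝ) 1) :
    ∃ K : ℝ, 0 < K ∧ ∀ π : Policy S A, ‖occ τ μ0 γ π.1‖ ≤ K := by
  let G : ℝ := ∑' t : ℕ, γ ^ t
  have hG : 0 ≤ G := tsum_nonneg fun t => pow_nonneg hγ.1.le t
  refine ⟨√(∑ _q : S × A, G ^ 2) + 1, by positivity, fun π => ?_⟩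
  rw [EuclideanSpace.norm_eq]
  refine le_trans (Real.sqrt_le_sqrt (Finset.sum_le_sum fun q _ => ?_)) (le_add_of_nonneg_right zero_le_one)
  have hs := summable_sd τ hτ μ0 hμ0 γ hγ π.1 π.2 q.1
  have h0 : 0 ≤ socc τ μ0 γ π.1 q.1 := tsum_nonneg fun t =>
    mul_nonneg (pow_nonneg hγ.1.le t) ((stateDist_dist τ hτ μ0 hμ0 π.1 π.2 t).1 _)
  have h1 : socc τ μ0 γ π.1 q.1 ≤ G := hs.tsum_le_tsum (fun t =>
    mul_le_of_le_one_right (pow_nonneg hγ.1.le t)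
      (isDist_le_one (stateDist_dist τ hτ μ0 hμ0 π.1 π.2 t) _))
      (summable_geometric_of_lt_one hγ.1.le hγ.2)
  have h2 : 0 ≤ occ τ μ0 γ π.1 q := mul_nonneg h0 ((π.2 q.1).1 q.2)
  have h3 : occ τ μ0 γ π.1 q ≤ G :=
    (mul_le_of_le_one_right h0 (isDist_le_one (π.2 q.1) q.2)).trans h1
  rw [Real.norm_of_nonneg h2]
  gcongr


theorem geom {V : Type*} [NormedAddCommGroup V] [InnerProductSpace ℝ V]
    (N : V → ℝ)
    (hNs : ∀ (r : ℝ) x, N (r • x) = |r| * N x) (hNa : ∀ x y, N (x + y) ≤ N x + N y)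
    (C2 C3 : ℝ) (hC2 : 0 < C2) (hC3 : 0 < C3)
    (h2 : ∀ x, N x ≤ C2 * ‖x‖) (h3 : ∀ x, ‖x‖ ≤ C3 * N x)
    (f1 f2 : V) (hf1 : N f1 = 1) (hf2 : N f2 = 1 ∨ f2 = 0) :
    ∃ w : V, inner ℝ f2 w ≤ 0 ∧ inner ℝ f1 w = ‖w‖ ^ 2 ∧
      ‖f1 - f2‖ ≤ (1 + 2 * C2 * C3) * ‖w‖ := by
  have hCC : 0 < C2 * C3 := mul_pos hC2 hC3
  rcases hf2 with hf2 | rfl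
  · have hf20 : f2 ≠ 0 := by
      rintro rfl
      have := h2 0
      rw [hf2, norm_zero] at this
      linarith
    have hpos : 0 < ‖f2‖ ^ 2 := by positivity
    -- general bound
    have gen : ∀ a : ℝ, 0 ≤ a → ‖f1 - f2‖ ≤ (1 + 2 * C2 * C3) * ‖f1 - a • f2‖ := by
      intro a ha
      set w := f1 - a • f2 with hw
      have e1 : f1 = w + a • f2 := by rw [hw]; abel
      have e2 : a • f2 = f1 + (-1 : ℝ) • w := by rw [hw]; module
      have i1 : 1 ≤ N w + a := by
        have := hNa w (a • f2)
        rw [← e1, hNs, abs_of_nonneg ha, hf1, hf2] at this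
        linarith
      have i2 : a ≤ 1 + N w := by
        have := hNa f1 ((-1 : ℝ) • w)
        rw [← e2, hNs, hNs, abs_of_nonneg ha, hf1, hf2] at this
        simpa using this
      have e3 : f1 - f2 = w + (a - 1) • f2 := by rw [hw]; module
      have i3 : N (f1 - f2) ≤ 2 * N w := by
        rw [e3]
        refine (hNa _ _).trans ?_
        rw [hNs, hf2]
        have : |a - 1| ≤ N w := abs_le.2 ⟨by linarith, by linarith⟩
        linarith
      have i4 := h3 (f1 - f2)
      have i5 := h2 w
      have i6 : C3 * N (f1 - f2) ≤ C3 * (2 * (C2 * ‖w‖)) :=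
        mul_le_mul_of_nonneg_left (by linarith) hC3.le
      nlinarith [norm_nonneg w]
    by_cases hneg : inner ℝ f1 f2 ≤ 0
    · refine ⟨f1, by rwa [real_inner_comm], real_inner_self_eq_norm_sq f1, ?_⟩
      simpa using gen 0 le_rfl
    · push Not at hneg
      let a := inner ℝ f1 f2 / ‖f2‖ ^ 2
      have ha : a * ‖f2‖ ^ 2 = inner ℝ f1 f2 := div_mul_cancel₀ _ hpos.ne'
      have horth : inner ℝ f2 (f1 - a • f2) = 0 := by
        rw [inner_sub_right, inner_smul_right, real_inner_self_eq_norm_sq, ha, real_inner_comm,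
          sub_self]
      refine ⟨f1 - a • f2, horth.le, ?_, gen a (by positivity)⟩
      rw [← real_inner_self_eq_norm_sq (f1 - a • f2)]
      conv_rhs => rw [inner_sub_left, inner_smul_left, horth]
      simp
  · refine ⟨f1, by simp, real_inner_self_eq_norm_sq f1, ?_⟩
    rw [sub_zero]
    nlinarith [norm_nonneg f1]

/-- The reward that does not depend on the successor state. -/
def liftR (x : EuclideanSpace ℝ (S × A)) : Reward S A := fun s a _ => x (s, a)

theorem rho_lift (τ : S → A → S → ℝ) (hτ : ∀ s a, IsDist (τ s a))
    (x : EuclideanSpace ℝ (S × A)) : rho τ (liftR x) = x := by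
  ext ⟨s, a⟩
  rw [rho_apply]
  simp only [liftR]
  rw [← Finset.sum_mul, (hτ s a).2, one_mul]

end

/-- every STARC metric is complete. -/
theorem starc_is_complete
    {S A : Type*} [Fintype S] [Fintype A] [Nonempty S] [Nonempty A]
    (τ : S → A → S → ℝ) (hτ : ∀ s a, IsDist (τ s a))
    (μ0 : S → ℝ) (hμ0 : IsDist μ0)
    (γ : ℝ) (hγ : γ ∈ Set.Ioo (0 : ℝ) 1)
    (hreach : AllReachable τ μ0)
    (d : Reward S A → Reward S A → ℝ) (hd : IsSTARC γ τ d) :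
    Complete τ μ0 γ d := by
  obtain ⟨c, n, m, s, ⟨hclin, -, hceq⟩, ⟨hn0, hnz, hns, hna⟩, hs,
    ⟨⟨hm0, -, -, -⟩, p, l, u, hp, -, hu, hmp⟩, hd⟩ := hd
  let W : Submodule ℝ (EuclideanSpace ℝ (S × A)) := (LinearMap.range (shp γ τ))ᗮ
  -- the linear map `W → Reward`
  let Λ : W →ₗ[ℝ] Reward S A :=
    { toFun := fun w => c (liftR (w : EuclideanSpace ℝ (S × A)))
      map_add' := fun x y => by rw [← hclin.map_add]; rfl
      map_smul' := fun r x => by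
        rw [RingHom.id_apply, ← hclin.map_smul]; rfl }
  have hΛr : ∀ w, Λ w ∈ Set.range c := fun w => ⟨_, rfl⟩
  let F : Reward S A → W := fun R => W.orthogonalProjectionOnto (rho τ R)
  have hF : ∀ R, ∃ Φ, (F R : EuclideanSpace ℝ (S × A)) = rho τ R + shp γ τ Φ := by
    intro R
    have h1 : rho τ R - (F R : EuclideanSpace ℝ (S × A)) ∈ Wᗮ :=
      Submodule.sub_starProjection_mem_orthogonal _
    rw [Submodule.orthogonal_orthogonal] at h1
    obtain ⟨Φ, hΦ⟩ := h1
    refine ⟨-Φ, ?_⟩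
    rw [map_neg, hΦ]
    abel
  have hΛF : ∀ R, Λ (F R) = c R := by
    intro R
    obtain ⟨Φ, hΦ⟩ := hF R
    refine ((hceq _ _).2 ((differBy_iff γ τ hτ _ _).2 ⟨Φ, ?_⟩)).symm
    rw [rho_lift τ hτ, hΦ]
  let N : W → ℝ := fun w => n (Λ w)
  have hN0 : ∀ w, 0 ≤ N w := fun w => hn0 _ (hΛr w)
  have hNs : ∀ (r : ℝ) w, N (r • w) = |r| * N w := fun r w => by
    simp only [N, map_smul]
    exact hns _ (hΛr w) r
  have hNa : ∀ x y, N (x + y) ≤ N x + N y := fun x y => by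
    simp only [N, map_add]
    exact hna _ (hΛr x) _ (hΛr y)
  have hNz : ∀ w, N w = 0 → w = 0 := by
    intro w hw
    have h1 : Λ w = 0 := (hnz _ (hΛr w)).1 hw
    have h2 : c (liftR (w : EuclideanSpace ℝ (S × A))) = c 0 := by
      rw [hclin.map_zero]; exact h1
    obtain ⟨Φ, hΦ⟩ := (differBy_iff γ τ hτ _ _).1 ((hceq _ _).1 h2)
    rw [rho_lift τ hτ, map_zero] at hΦ
    have h3 : (w : EuclideanSpace ℝ (S × A)) ∈ LinearMap.range (shp γ τ) :=
      ⟨-Φ, by rw [map_neg]; exact (eq_neg_of_add_eq_zero_left hΦ.symm).symm⟩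
    have h4 : inner ℝ (w : EuclideanSpace ℝ (S × A)) w = 0 :=
      (Submodule.mem_orthogonal _ _).1 w.2 _ h3
    exact Subtype.ext (inner_self_eq_zero.1 h4)
  obtain ⟨hp0, hpz, hps, hpa⟩ := hp
  obtain ⟨C1, hC1, hC1b⟩ := seminorm_bound (E := W) (fun w => ‖w‖) (fun w => p (Λ w))
    (fun w => norm_nonneg w) (fun w => norm_eq_zero.1) (fun r w => norm_smul r w) norm_add_le
    (fun w => hp0 _ trivial) (fun r w => by rw [map_smul]; exact hps _ trivial r)
    (fun x y => by rw [map_add]; exact hpa _ trivial _ trivial)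
  obtain ⟨C2, hC2, hC2b⟩ := seminorm_bound (E := W) (fun w => ‖w‖) N
    (fun w => norm_nonneg w) (fun w => norm_eq_zero.1) (fun r w => norm_smul r w) norm_add_le
    hN0 hNs hNa
  obtain ⟨C3, hC3, hC3b⟩ := seminorm_bound (E := W) N (fun w => ‖w‖) hN0 hNz hNs hNa
    (fun w => norm_nonneg w) (fun r w => norm_smul r w) norm_add_le
  -- normalised representatives
  let f : Reward S A → W := fun R => (N (F R))⁻¹ • F R
  have hgf : ∀ R, F R = N (F R) • f R := by
    intro R
    by_cases h : N (F R) = 0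
    · rw [h, zero_smul]; exact hNz _ h
    · simp only [f]
      rw [smul_smul, mul_inv_cancel₀ h, one_smul]
  have hfz : ∀ R, N (F R) = 0 → f R = 0 := by
    intro R h
    simp only [f]
    rw [hNz _ h, smul_zero]
  have hf1 : ∀ R, N (F R) ≠ 0 → N (f R) = 1 := by
    intro R h
    simp only [f]
    rw [hNs, abs_of_nonneg (inv_nonneg.2 (hN0 _)), inv_mul_cancel₀ h]
  have hsf : ∀ R, s R = Λ (f R) := by
    intro R
    by_cases h : N (F R) = 0
    · have h' : n (c R) = 0 := by rw [← hΛF]; exact h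
      rw [(hs R).1 h', hfz R h, map_zero, ← hΛF, hNz _ h, map_zero]
    · have h' : n (c R) ≠ 0 := by rw [← hΛF]; exact h
      rw [(hs R).2 h']
      simp only [f, N]
      rw [map_smul, hΛF]
  have hdle : ∀ R1 R2, d R1 R2 ≤ u * C1 * ‖f R1 - f R2‖ := by
    intro R1 R2
    rw [hd]
    refine (hmp _ ⟨R1, rfl⟩ _ ⟨R2, rfl⟩).2.trans ?_
    rw [hsf, hsf, ← map_sub, mul_assoc]
    exact mul_le_mul_of_nonneg_left (hC1b _) hu.le
  have hd0 : ∀ R1 R2, f R1 = f R2 → d R1 R2 = 0 := by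
    intro R1 R2 h
    have : s R1 = s R2 := by rw [hsf, hsf, h]
    rw [hd, this]
    exact hm0 _ ⟨R2, rfl⟩
  -- differences of returns
  have hJ : ∀ R (w : W), inner ℝ (w : EuclideanSpace ℝ (S × A)) (rho τ R) =
      inner ℝ (F R) w := by
    intro R w
    obtain ⟨Φ, hΦ⟩ := hF R
    rw [Submodule.coe_inner, hΦ, inner_add_left,
      (Submodule.mem_orthogonal _ _).1 w.2 _ ⟨Φ, rfl⟩, add_zero, real_inner_comm]
  have hmemW : ∀ π π' : Policy S A, occ τ μ0 γ π.1 - occ τ μ0 γ π'.1 ∈ W := by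
    intro π π'
    refine (Submodule.mem_orthogonal _ _).2 ?_
    rintro _ ⟨Φ, rfl⟩
    rw [inner_sub_right, inner_shp_occ τ hτ μ0 hμ0 γ hγ π.1 π.2,
      inner_shp_occ τ hτ μ0 hμ0 γ hγ π'.1 π'.2, sub_self]
  have hJd : ∀ R (π π' : Policy S A), J τ μ0 γ R π.1 - J τ μ0 γ R π'.1 =
      inner ℝ (F R) (⟨_, hmemW π π'⟩ : W) := by
    intro R π π'
    rw [← hJ, J_eq τ hτ μ0 hμ0 γ hγ π.1 π.2, J_eq τ hτ μ0 hμ0 γ hγ π'.1 π'.2, inner_sub_left]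
  obtain ⟨π0, ε, hε, hint⟩ := exists_interior τ hτ μ0 hμ0 γ hγ hreach
  obtain ⟨K, hK, hKb⟩ := J_diff_le (A := A) τ hτ μ0 hμ0 γ hγ
  -- small perturbations are realised
  have hreal : ∀ w : W, ‖w‖ ≤ ε → ∃ π : Policy S A, ∀ R,
      J τ μ0 γ R π.1 - J τ μ0 γ R π0.1 = inner ℝ (F R) w := by
    intro w hw
    obtain ⟨π, hπ⟩ := realize τ hτ μ0 hμ0 γ hγ (occ τ μ0 γ π0.1 + w) (fun q => by
        have h1 := hint q
        have h2 : |(w : EuclideanSpace ℝ (S × A)) q| ≤ ε :=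
          (PiLp.norm_apply_le (w : EuclideanSpace ℝ (S × A)) q).trans hw
        have h3 := (abs_le.1 h2).1
        rw [PiLp.add_apply]
        linarith) (fun Φ => by
        rw [inner_add_right, inner_shp_occ τ hτ μ0 hμ0 γ hγ π0.1 π0.2,
          (Submodule.mem_orthogonal _ _).1 w.2 _ ⟨Φ, rfl⟩, add_zero])
    refine ⟨π, fun R => ?_⟩
    rw [hJd]
    congr 1
    apply Subtype.ext
    change occ τ μ0 γ π.1 - occ τ μ0 γ π0.1 = w
    rw [hπ]
    abel
  let C : ℝ := 1 + 2 * C2 * C3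
  have hC : 0 < C := by positivity
  -- core claim
  have core : ∀ R1 R2, ∃ π1 : Policy S A, J τ μ0 γ R2 π1.1 ≤ J τ μ0 γ R2 π0.1 ∧
      ε / C * N (F R1) * ‖f R1 - f R2‖ ≤ J τ μ0 γ R1 π1.1 - J τ μ0 γ R1 π0.1 := by
    intro R1 R2
    by_cases h1 : N (F R1) = 0
    · exact ⟨π0, le_rfl, by rw [h1]; simp⟩
    have h2 : N (f R2) = 1 ∨ f R2 = 0 := by
      by_cases h2 : N (F R2) = 0
      · exact Or.inr (hfz _ h2)
      · exact Or.inl (hf1 _ h2)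
    obtain ⟨w, hw2, hw1, hwC⟩ := geom N hNs hNa C2 C3 hC2 hC3 hC2b hC3b (f R1) (f R2) (hf1 _ h1) h2
    have hwn : ‖w‖ * ‖w‖⁻¹ ≤ 1 := mul_inv_le_one
    have hiw : 0 ≤ ‖w‖⁻¹ := inv_nonneg.2 (norm_nonneg w)
    obtain ⟨π, hπ⟩ := hreal ((ε * ‖w‖⁻¹) • w) (by
      rw [norm_smul, Real.norm_of_nonneg (by positivity)]
      nlinarith)
    have hin : ∀ R, J τ μ0 γ R π.1 - J τ μ0 γ R π0.1 =
        N (F R) * (ε * ‖w‖⁻¹ * inner ℝ (f R) w) := by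
      intro R
      rw [hπ R, inner_smul_right]
      conv_lhs => rw [hgf R, inner_smul_left]
      simp only [conj_trivial]
      ring
    refine ⟨π, ?_, ?_⟩
    · have h := hin R2
      have : N (F R2) * (ε * ‖w‖⁻¹ * inner ℝ (f R2) w) ≤ 0 :=
        mul_nonpos_of_nonneg_of_nonpos (hN0 _)
          (mul_nonpos_of_nonneg_of_nonpos (by positivity) hw2)
      linarith
    · rw [hin R1, hw1]
      have e : ‖w‖⁻¹ * ‖w‖ ^ 2 = ‖w‖ := by
        by_cases hw0 : ‖w‖ = 0
        · rw [hw0]; simp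
        · field_simp
      have e2 : N (F R1) * (ε * ‖w‖⁻¹ * ‖w‖ ^ 2) = ε * N (F R1) * ‖w‖ := by
        rw [mul_assoc ε, e]; ring
      rw [e2]
      have i : ‖f R1 - f R2‖ / C ≤ ‖w‖ := by
        rw [div_le_iff₀ hC, mul_comm]; exact hwC
      have e3 : ε / C * N (F R1) * ‖f R1 - f R2‖ = ε * N (F R1) * (‖f R1 - f R2‖ / C) := by
        ring
      rw [e3]
      exact mul_le_mul_of_nonneg_left i (mul_nonneg hε.le (hN0 _))
  -- the range of returns
  have hrange : ∀ R, maxJ τ μ0 γ R - minJ τ μ0 γ R ≤ 2 * K * C3 * N (F R) := by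
    intro R
    have hb : ∀ π π' : Policy S A, J τ μ0 γ R π.1 ≤ 2 * K * C3 * N (F R) + J τ μ0 γ R π'.1 := by
      intro π π'
      have h1 := hJd R π π'
      have h2 := real_inner_le_norm (F R) (⟨_, hmemW π π'⟩ : W)
      have h3 : ‖(⟨_, hmemW π π'⟩ : W)‖ ≤ 2 * K := by
        change ‖occ τ μ0 γ π.1 - occ τ μ0 γ π'.1‖ ≤ 2 * K
        have := norm_sub_le (occ τ μ0 γ π.1) (occ τ μ0 γ π'.1)
        have := hKb π
        have := hKb π'
        linarith
      have h4 := mul_le_mul (hC3b (F R)) h3 (norm_nonneg _) (mul_nonneg hC3.le (hN0 _))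
      nlinarith
    haveI : Nonempty (Policy S A) := ⟨π0⟩
    have h1 : ∀ π' : Policy S A, maxJ τ μ0 γ R ≤ 2 * K * C3 * N (F R) + J τ μ0 γ R π'.1 :=
      fun π' => ciSup_le fun π => hb π π'
    have h2 : maxJ τ μ0 γ R - 2 * K * C3 * N (F R) ≤ minJ τ μ0 γ R :=
      le_ciInf fun π' => by have := h1 π'; linarith
    linarith
  have hrange0 : ∀ R, 0 ≤ maxJ τ μ0 γ R - minJ τ μ0 γ R := by
    intro R
    have hb : ∀ π : Policy S A, |J τ μ0 γ R π.1| ≤ K * ‖rho τ R‖ := by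
      intro π
      rw [J_eq τ hτ μ0 hμ0 γ hγ π.1 π.2]
      exact (abs_real_inner_le_norm _ _).trans
        (mul_le_mul_of_nonneg_right (hKb π) (norm_nonneg _))
    have h1 : J τ μ0 γ R π0.1 ≤ maxJ τ μ0 γ R :=
      le_ciSup (f := fun π : Policy S A => J τ μ0 γ R π.1)
        ⟨K * ‖rho τ R‖, by rintro _ ⟨π, rfl⟩; exact (abs_le.1 (hb π)).2⟩ π0
    have h2 : minJ τ μ0 γ R ≤ J τ μ0 γ R π0.1 :=
      ciInf_le (f := fun π : Policy S A => J τ μ0 γ R π.1)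
        ⟨-(K * ‖rho τ R‖), by rintro _ ⟨π, rfl⟩; exact (abs_le.1 (hb π)).1⟩ π0
    linarith
  constructor
  · let B : ℝ := 2 * K * C3 * (u * C1)
    have hB : 0 < B := by positivity
    refine ⟨ε / C / B, by positivity, fun R1 R2 => ?_⟩
    obtain ⟨π1, h1, h2⟩ := core R1 R2
    refine ⟨π1, π0, h1, le_trans ?_ h2⟩
    have h3 : (maxJ τ μ0 γ R1 - minJ τ μ0 γ R1) * d R1 R2 ≤
        B * (N (F R1) * ‖f R1 - f R2‖) := by
      calc _ ≤ (maxJ τ μ0 γ R1 - minJ τ μ0 γ R1) * (u * C1 * ‖f R1 - f R2‖) :=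
            mul_le_mul_of_nonneg_left (hdle R1 R2) (hrange0 R1)
        _ ≤ (2 * K * C3 * N (F R1)) * (u * C1 * ‖f R1 - f R2‖) :=
            mul_le_mul_of_nonneg_right (hrange R1) (by positivity)
        _ = _ := by simp only [B]; ring
    calc _ = ε / C / B * ((maxJ τ μ0 γ R1 - minJ τ μ0 γ R1) * d R1 R2) := by ring
      _ ≤ ε / C / B * (B * (N (F R1) * ‖f R1 - f R2‖)) :=
          mul_le_mul_of_nonneg_left h3 (by positivity)
      _ = _ := by field_simp
  · intro R1 R2 hso
    have main : ∀ R1 R2, SameOrder τ μ0 γ R1 R2 → N (F R1) ≠ 0 → f R1 = f R2 := by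
      intro R1 R2 hso hne
      obtain ⟨π1, h1, h2⟩ := core R1 R2
      have h3 := (hso π1 π0).2 h1
      have h4 : 0 < ε / C * N (F R1) :=
        mul_pos (by positivity) (lt_of_le_of_ne (hN0 _) hne.symm)
      have h5 : ‖f R1 - f R2‖ ≤ 0 := by
        by_contra hcon
        push Not at hcon
        have := mul_pos h4 hcon
        linarith
      exact sub_eq_zero.1 (norm_le_zero_iff.1 h5)
    apply hd0
    by_cases h1 : N (F R1) = 0
    · by_cases h2 : N (F R2) = 0
      · rw [hfz _ h1, hfz _ h2]
      · exact (main R2 R1 (fun π π' => (hso π π').symm) h2).symm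
    · exact main R1 R2 hso h1

end RewardPaper
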